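/- Suppose there exists a continuous ω = (ω_2,…,ω_m) : U → ℝ^{m−1} such that for every a ∈ U there exist r > 0 with the open Euclidean ball B(a,r) ⊆ U and a family {φ_ε ∈ C^1(B(a,r)) : 0 < ε < 1} such that, as ε → 0, φ_ε → φ uniformly on B(a,r) and, for every j = 2,…,m, D^{φ_ε}_jφ_ε → ω_j uniformly on B(a,r), where D^{φ_ε}_jφ_ε(w) := ∂_{x_j}φ_ε(w) − Σ_{i=1}^h ( b^(i)_{j1} φ_ε(w) + (1/2) Σ_{k=2}^m x_k b^(i)_{jk} ) ∂_{y_i}φ_ε(w). Then D^φφ = ω in the broad* sense on U. -/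

import Mathlib

open MeasureTheory Filter Topology

namespace Step2

/-- The underlying space of the step-2 Carnot group `G = ℝ^m × ℝ^h`. -/
abbrev G (m h : ℕ) := (Fin m → ℝ) × (Fin h → ℝ)

variable {m h : ℕ}

/-- Group product `(x,y)·(x',y') = (x+x', y+y' - (1/2)⟨Bx,x'⟩)`. -/
noncomputable def gmul (B : Fin h → Matrix (Fin m) (Fin m) ℝ) (p q : G m h) : G m h :=
  (p.1 + q.1, fun i => p.2 i + q.2 i - (1 / 2) * ∑ j, ∑ k, B i j k * p.1 k * q.1 j)

/-- Group inverse `g⁻¹ = -g`. -/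
def ginv (p : G m h) : G m h := (-p.1, -p.2)

/-- Homogeneous norm `‖(x,y)‖ = Σ|x_j| + Σ|y_i|^(1/2)`. -/
noncomputable def hnorm (p : G m h) : ℝ :=
  (∑ j, |p.1 j|) + ∑ i, Real.sqrt |p.2 i|

/-- Homogeneous (quasi-)distance `d(p,q) = ‖p⁻¹·q‖`. -/
noncomputable def gdist (B : Fin h → Matrix (Fin m) (Fin m) ℝ) (p q : G m h) : ℝ :=
  hnorm (gmul B (ginv p) q)

/-- Euclidean distance on `G`. -/
noncomputable def eDist (p q : G m h) : ℝ :=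
  Real.sqrt ((∑ j, (p.1 j - q.1 j) ^ 2) + ∑ i, (p.2 i - q.2 i) ^ 2)

/-- The subgroup `W = {x_1 = 0}`. -/
def Wset (m h : ℕ) [NeZero m] : Set (G m h) := {p | p.1 0 = 0}

/-- `U` is (relatively) open in `W`. -/
def RelOpen (m h : ℕ) [NeZero m] (U : Set (G m h)) : Prop :=
  ∃ O : Set (G m h), IsOpen O ∧ U = O ∩ Wset m h

/-- The graphing map `Φ(w) = (φ(w),0,…,0) ∈ L`. -/
noncomputable def Phi [NeZero m] (φ : G m h → ℝ) (w : G m h) : G m h :=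
  ((fun j => if j = 0 then φ w else 0), 0)

/-- Horizontal coordinate vector `e_{x_j}`. -/
def eH (m h : ℕ) (j : Fin m) : G m h := ((fun j' => if j' = j then 1 else 0), 0)

/-- Vertical coordinate vector `e_{y_i}`. -/
def eV (m h : ℕ) (i : Fin h) : G m h := (0, fun i' => if i' = i then 1 else 0)

/-- The projected vector field `D^φ_j` (for `j ≠ 0`, i.e. `j = 2,…,m` in 1-based indexing):
`D^φ_j|_w = ∂_{x_j} - Σ_i ( b^(i)_{j1} φ(w) + (1/2) Σ_{k≥2} x_k b^(i)_{jk} ) ∂_{y_i}`. -/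
noncomputable def Dvec [NeZero m] (B : Fin h → Matrix (Fin m) (Fin m) ℝ)
    (φ : G m h → ℝ) (j : Fin m) (w : G m h) : G m h :=
  ((fun j' => if j' = j then 1 else 0),
   fun i => -(B i j 0 * φ w
      + (1 / 2) * ∑ k ∈ Finset.univ.erase (0 : Fin m), w.1 k * B i j k))

/-- `D^φφ = ω` in the broad* sense on `U`. -/
def IsBroadStar [NeZero m] (B : Fin h → Matrix (Fin m) (Fin m) ℝ) (U : Set (G m h))
    (φ : G m h → ℝ) (ω : G m h → Fin m → ℝ) : Prop :=
  ∀ a₀ ∈ U, ∃ δ₁ δ₂ : ℝ, 0 < δ₂ ∧ δ₂ < δ₁ ∧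
    ∀ j : Fin m, j ≠ 0 → ∃ E : G m h → ℝ → G m h,
      ∀ a, a ∈ U → eDist a a₀ ≤ δ₂ →
        (∀ t ∈ Set.Icc (-δ₂) δ₂, E a t ∈ U ∧ eDist (E a t) a₀ ≤ δ₁) ∧
        E a 0 = a ∧
        (∀ t ∈ Set.Icc (-δ₂) δ₂,
          HasDerivWithinAt (E a) (Dvec B φ j (E a t)) (Set.Icc (-δ₂) δ₂) t) ∧
        (∀ t ∈ Set.Icc (-δ₂) δ₂, φ (E a t) - φ a = ∫ s in (0:ℝ)..t, ω (E a s) j)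

/-- `φ` is vertically broad* Hölder on `U`. -/
def VertHolder (m h : ℕ) [NeZero m] (U : Set (G m h)) (φ : G m h → ℝ) : Prop :=
  ∀ a₀ ∈ U, ∃ U' : Set (G m h), RelOpen m h U' ∧ a₀ ∈ U' ∧
    IsCompact (closure U') ∧ closure U' ⊆ U ∧
    ∀ i : Fin h, ∀ ε > (0:ℝ), ∃ ρ > (0:ℝ), ∀ p ∈ U', ∀ q ∈ U',
      p.1 = q.1 → (∀ i' : Fin h, i' ≠ i → p.2 i' = q.2 i') →
      0 < |p.2 i - q.2 i| → |p.2 i - q.2 i| ≤ ρ →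
      |φ p - φ q| ≤ ε * Real.sqrt |p.2 i - q.2 i|

/-- The translated point `Φ(a)⁻¹·a⁻¹·b·Φ(a)`. -/
noncomputable def shiftQ [NeZero m] (B : Fin h → Matrix (Fin m) (Fin m) ℝ)
    (φ : G m h → ℝ) (a b : G m h) : G m h :=
  gmul B (gmul B (gmul B (ginv (Phi φ a)) (ginv a)) b) (Phi φ a)

/-- `φ` is intrinsically differentiable at `a₀` with intrinsic gradient `grad`. -/
def IDAt [NeZero m] (B : Fin h → Matrix (Fin m) (Fin m) ℝ) (U : Set (G m h))
    (φ : G m h → ℝ) (a₀ : G m h) (grad : Fin m → ℝ) : Prop :=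
  ∀ ε > (0:ℝ), ∃ r > (0:ℝ), ∀ b ∈ U, 0 < gdist B a₀ b → gdist B a₀ b < r →
    |φ b - φ a₀ - ∑ j ∈ Finset.univ.erase (0 : Fin m), grad j * (b.1 j - a₀.1 j)|
      ≤ ε * hnorm (shiftQ B φ a₀ b)

/-- `φ` is uniformly intrinsically differentiable at `a₀` with intrinsic gradient `grad`. -/
def UIDAt [NeZero m] (B : Fin h → Matrix (Fin m) (Fin m) ℝ) (U : Set (G m h))
    (φ : G m h → ℝ) (a₀ : G m h) (grad : Fin m → ℝ) : Prop :=
  ∀ ε > (0:ℝ), ∃ r > (0:ℝ), ∀ a ∈ U, ∀ b ∈ U,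
    gdist B a₀ a < r → gdist B a₀ b < r → a ≠ b →
    |φ b - φ a - ∑ j ∈ Finset.univ.erase (0 : Fin m), grad j * (b.1 j - a.1 j)|
      ≤ ε * hnorm (shiftQ B φ a b)

/-- Projection onto `L` in the splitting `G = W·L`. -/
def piL (m h : ℕ) [NeZero m] (g : G m h) : G m h :=
  ((fun j => if j = 0 then g.1 0 else 0), 0)

/-- Projection onto `W` in the splitting `G = W·L`. -/
noncomputable def piW [NeZero m] (B : Fin h → Matrix (Fin m) (Fin m) ℝ) (g : G m h) : G m h :=
  ((fun j => if j = 0 then 0 else g.1 j),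
   fun i => g.2 i + (1 / 2) * g.1 0 * ∑ k ∈ Finset.univ.erase (0 : Fin m), B i 0 k * g.1 k)

/-- Coordinates `ℝ^(m-1) × ℝ^h → W ⊆ G`. -/
def emb (m h : ℕ) (u : (Fin (m - 1) → ℝ) × (Fin h → ℝ)) : G m h :=
  ((fun j => if hj : (j : ℕ) = 0 then 0
      else u.1 ⟨(j : ℕ) - 1, by have := j.isLt; omega⟩), u.2)

/-- The Lebesgue measure on `W`, as a measure on `G`. -/
noncomputable def muW (m h : ℕ) : Measure (G m h) :=
  Measure.map (emb m h) volume

end Step2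

namespace Step2

/-- The Picard–Lindelöf theorem with a globally defined Lipschitz solution that stays in the ball. -/
theorem exists_lipschitz_solution {E : Type*} [NormedAddCommGroup E] [NormedSpace ℝ E]
    [CompleteSpace E] {f : ℝ → E → E} {tmin tmax : ℝ} {t₀ : Set.Icc tmin tmax} {x₀ x : E}
    {a r L K : NNReal} (hf : IsPicardLindelof f t₀ x₀ a r L K)
    (hx : x ∈ Metric.closedBall x₀ r) :
    ∃ α : ℝ → E, LipschitzWith L α ∧ α t₀ = x ∧ (∀ t, α t ∈ Metric.closedBall x₀ a) ∧
      ∀ t ∈ Set.Icc tmin tmax,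
        HasDerivWithinAt α (f t (α t)) (Set.Icc tmin tmax) t := by
  obtain ⟨α, hα⟩ := ODE.FunSpace.exists_isFixedPt_next hf hx
  have h : tmin ≤ tmax := t₀.2.1.trans t₀.2.2
  refine ⟨α.compProj, ?_, by rw [ODE.FunSpace.compProj_val, ← hα, ODE.FunSpace.next_apply₀],
    fun t => α.compProj_mem_closedBall hf.mul_max_le, fun t ht => ?_⟩
  · have hLip := α.lipschitzWith.comp (LipschitzWith.projIcc h)
    rwa [mul_one] at hLip
  · apply (ODE.hasDerivWithinAt_picard_Icc t₀.2 hf.continuousOn_uncurry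
      α.continuous_compProj.continuousOn
      (fun _ _ => α.compProj_mem_closedBall hf.mul_max_le) x ht).congr_of_mem _ ht
    intro t' ht'
    nth_rw 1 [← hα]
    rw [ODE.FunSpace.compProj_of_mem ht', ODE.FunSpace.next_apply]

/-- Arzelà–Ascoli for sequences of uniformly Lipschitz curves with values in a compact set. -/
theorem exists_subseq_tendsto_of_lipschitz {E : Type*} [MetricSpace E] {s : Set E}
    (hs : IsCompact s) {a b : ℝ} (hab : a ≤ b) {L : NNReal} {γ : ℕ → ℝ → E}
    (hγ : ∀ n, LipschitzWith L (γ n)) (hmem : ∀ n, ∀ t ∈ Set.Icc a b, γ n t ∈ s) :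
    ∃ γ₀ : ℝ → E, Continuous γ₀ ∧ ∃ ψ : ℕ → ℕ, StrictMono ψ ∧
      ∀ t ∈ Set.Icc a b, Tendsto (fun n => γ (ψ n) t) atTop (𝓝 (γ₀ t)) := by
  let g : ℕ → BoundedContinuousFunction (Set.Icc a b) E := fun n =>
    BoundedContinuousFunction.mkOfCompact
      ⟨fun t => γ n t, (hγ n).continuous.comp continuous_subtype_val⟩
  have hcomp : IsCompact (closure (Set.range g)) := by
    refine BoundedContinuousFunction.arzela_ascoli s hs _ ?_ ?_
    · rintro _ t ⟨n, rfl⟩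
      exact hmem n t t.2
    · refine (LipschitzWith.uniformEquicontinuous _ L ?_).equicontinuous
      rintro ⟨_, n, rfl⟩
      rw [← mul_one L]
      exact (hγ n).comp (LipschitzWith.subtype_val (Set.Icc a b))
  obtain ⟨g₀, -, ψ, hψ, hlim⟩ :=
    hcomp.tendsto_subseq (fun n => subset_closure (Set.mem_range_self n))
  refine ⟨Set.IccExtend hab g₀, g₀.continuous.Icc_extend', ψ, hψ, fun t ht => ?_⟩
  rw [Set.IccExtend_of_mem hab _ ht]
  exact (BoundedContinuousFunction.tendsto_iff_tendstoUniformly.1 hlim).tendsto_at ⟨t, ht⟩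

/-- The fundamental theorem of calculus passes to pointwise limits of functions with uniformly
bounded continuous derivatives. -/
theorem sub_eq_integral_of_tendsto {E : Type*} [NormedAddCommGroup E] [NormedSpace ℝ E]
    [CompleteSpace E] {a b t₀ : ℝ} (ht₀ : t₀ ∈ Set.Icc a b) {F f : ℕ → ℝ → E} {F₀ f₀ : ℝ → E}
    (hF : ∀ n, ∀ t ∈ Set.Icc a b, HasDerivWithinAt (F n) (f n t) (Set.Icc a b) t)
    (hf : ∀ n, ContinuousOn (f n) (Set.Icc a b)) {C : ℝ}
    (hC : ∀ᶠ n in atTop, ∀ t ∈ Set.Icc a b, ‖f n t‖ ≤ C)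
    (hFlim : ∀ t ∈ Set.Icc a b, Tendsto (fun n => F n t) atTop (𝓝 (F₀ t)))
    (hflim : ∀ t ∈ Set.Icc a b, Tendsto (fun n => f n t) atTop (𝓝 (f₀ t))) :
    ∀ t ∈ Set.Icc a b, F₀ t - F₀ t₀ = ∫ s in t₀..t, f₀ s := by
  intro t ht
  have hsub : Set.uIcc t₀ t ⊆ Set.Icc a b := Set.uIcc_subset_Icc ht₀ ht
  have hsub' : Set.uIoc t₀ t ⊆ Set.Icc a b := Set.uIoc_subset_uIcc.trans hsub
  have hint : ∀ n, F n t - F n t₀ = ∫ s in t₀..t, f n s := by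
    intro n
    refine (intervalIntegral.integral_eq_sub_of_hasDeriv_right
      (fun s hs => ((hF n s (hsub hs)).continuousWithinAt.mono hsub)) (fun s hs => ?_)
      ((hf n).mono hsub).intervalIntegrable).symm
    have hs' : s ∈ Set.Ioo a b :=
      ⟨(le_min ht₀.1 ht.1).trans_lt hs.1, hs.2.trans_le (max_le ht₀.2 ht.2)⟩
    exact ((hF n s (Set.Ioo_subset_Icc_self hs')).hasDerivAt
      (Icc_mem_nhds hs'.1 hs'.2)).hasDerivWithinAt
  refine tendsto_nhds_unique ((hFlim t ht).sub (hFlim t₀ ht₀)) ?_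
  simp_rw [hint]
  refine intervalIntegral.tendsto_integral_filter_of_dominated_convergence (fun _ => C)
    (Eventually.of_forall fun n => ((hf n).mono hsub').aestronglyMeasurable measurableSet_uIoc)
    ?_ intervalIntegrable_const (Eventually.of_forall fun s hs => hflim s (hsub' hs))
  filter_upwards [hC] with n hn
  exact Eventually.of_forall fun s hs => hn s (hsub' hs)

theorem continuous_eDist (q : G m h) : Continuous fun p : G m h => eDist p q := by
  unfold eDist
  fun_prop

theorem dist_le_eDist (p q : G m h) : dist p q ≤ eDist p q := by
  have h0 : 0 ≤ eDist p q := Real.sqrt_nonneg _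
  have h1 : 0 ≤ ∑ j, (p.1 j - q.1 j) ^ 2 := Finset.sum_nonneg fun j _ => sq_nonneg _
  have h2 : 0 ≤ ∑ i, (p.2 i - q.2 i) ^ 2 := Finset.sum_nonneg fun i _ => sq_nonneg _
  rw [Prod.dist_eq]
  refine max_le ((dist_pi_le_iff h0).2 fun j => ?_) ((dist_pi_le_iff h0).2 fun i => ?_)
  · rw [Real.dist_eq]
    refine Real.abs_le_sqrt ?_
    have := Finset.single_le_sum (f := fun j => (p.1 j - q.1 j) ^ 2)
      (fun j _ => sq_nonneg _) (Finset.mem_univ j)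
    linarith
  · rw [Real.dist_eq]
    refine Real.abs_le_sqrt ?_
    have := Finset.single_le_sum (f := fun i => (p.2 i - q.2 i) ^ 2)
      (fun i _ => sq_nonneg _) (Finset.mem_univ i)
    linarith

/-- The linear projection of `G` onto `W` along `L`. -/
def dropFirst (m h : ℕ) [NeZero m] (w : G m h) : G m h :=
  (fun j => if j = 0 then 0 else w.1 j, w.2)

section

variable {m h : ℕ} [NeZero m]

theorem isClosed_Wset : IsClosed (Wset m h) :=
  isClosed_eq (by fun_prop) continuous_const

theorem dropFirst_mem_Wset (w : G m h) : dropFirst m h w ∈ Wset m h := by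
  simp [dropFirst, Wset]

theorem dropFirst_of_mem_Wset {w : G m h} (hw : w ∈ Wset m h) : dropFirst m h w = w := by
  refine Prod.ext (funext fun j => ?_) rfl
  by_cases hj : j = 0
  · subst hj
    simpa [dropFirst] using (show w.1 0 = 0 from hw).symm
  · simp [dropFirst, hj]

theorem contDiff_dropFirst : ContDiff ℝ 1 (dropFirst m h) := by
  refine ContDiff.prodMk (contDiff_pi.2 fun j => ?_) contDiff_snd
  by_cases hj : j = 0
  · simpa [hj] using contDiff_const
  · simp only [hj, if_false]
    fun_prop

theorem dist_dropFirst_le {w a : G m h} (ha : a ∈ Wset m h) :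
    dist (dropFirst m h w) a ≤ dist w a := by
  rw [Prod.dist_eq, Prod.dist_eq]
  refine max_le_max ((dist_pi_le_iff dist_nonneg).2 fun j => ?_) le_rfl
  by_cases hj : j = 0
  · subst hj
    have : a.1 0 = 0 := ha
    simp [dropFirst, this]
  · simpa [dropFirst, hj] using dist_le_pi_dist w.1 a.1 j

theorem contDiff_Dvec (B : Fin h → Matrix (Fin m) (Fin m) ℝ) (j : Fin m) :
    ContDiff ℝ 1 fun q : ℝ × G m h => Dvec B (fun _ => q.1) j q.2 := by
  refine ContDiff.prodMk contDiff_const (contDiff_pi.2 fun i => ?_)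
  fun_prop

theorem contDiffOn_Dvec (B : Fin h → Matrix (Fin m) (Fin m) ℝ) (j : Fin m) {f : G m h → ℝ}
    {s : Set (G m h)} (hf : ContDiffOn ℝ 1 f s) : ContDiffOn ℝ 1 (Dvec B f j) s :=
  (contDiff_Dvec B j).comp_contDiffOn (hf.prodMk contDiffOn_id)

theorem continuousOn_Dvec (B : Fin h → Matrix (Fin m) (Fin m) ℝ) (j : Fin m) {f : G m h → ℝ}
    {s : Set (G m h)} (hf : ContinuousOn f s) : ContinuousOn (Dvec B f j) s :=
  (contDiff_Dvec B j).continuous.comp_continuousOn (hf.prodMk continuousOn_id)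

/-- Integral curves of `D^f_j` for a `C¹` function `f` exist inside `W` for a time controlled by a
bound of the field on `W` only. -/
theorem exists_integralCurve_Dvec (B : Fin h → Matrix (Fin m) (Fin m) ℝ) {j : Fin m}
    (hj : j ≠ 0) {f : G m h → ℝ} {a₀ a : G m h} (ha₀ : a₀ ∈ Wset m h) {ρ δ M : NNReal}
    (hf : ContDiffOn ℝ 1 f (Metric.closedBall a₀ ρ))
    (hM : ∀ w ∈ Metric.closedBall a₀ ρ ∩ Wset m h, ‖Dvec B f j w‖ ≤ M)
    (hδ : (M * δ + δ : ℝ) ≤ ρ) (ha : a ∈ Wset m h) (haδ : dist a a₀ ≤ δ) :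
    ∃ γ : ℝ → G m h, LipschitzWith M γ ∧ γ 0 = a ∧
      (∀ t ∈ Set.Icc (-δ : ℝ) δ, γ t ∈ Metric.closedBall a₀ ρ ∩ Wset m h) ∧
      ∀ t ∈ Set.Icc (-δ : ℝ) δ,
        HasDerivWithinAt γ (Dvec B f j (γ t)) (Set.Icc (-δ : ℝ) δ) t := by
  have hmaps : Set.MapsTo (dropFirst m h) (Metric.closedBall a₀ ρ) (Metric.closedBall a₀ ρ) :=
    fun w hw => (dist_dropFirst_le ha₀).trans hw
  have hfP : ContDiffOn ℝ 1 (f ∘ dropFirst m h) (Metric.closedBall a₀ ρ) :=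
    hf.comp contDiff_dropFirst.contDiffOn hmaps
  obtain ⟨K, hK⟩ := (contDiffOn_Dvec B j hfP).exists_lipschitzOnWith one_ne_zero
    (convex_closedBall a₀ _) (isCompact_closedBall a₀ _)
  have hsame : ∀ w, Dvec B (f ∘ dropFirst m h) j w = Dvec B f j (dropFirst m h w) := by
    intro w
    refine Prod.ext rfl (funext fun i => ?_)
    simp only [Dvec, Function.comp_apply]
    congr 3
    refine Finset.sum_congr rfl fun k hk => ?_
    simp [dropFirst, Finset.ne_of_mem_erase hk]
  have h0 : (0 : ℝ) ∈ Set.Icc (-δ : ℝ) δ := by simp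
  have hPL : IsPicardLindelof (fun _ => Dvec B (f ∘ dropFirst m h) j)
      (⟨0, h0⟩ : Set.Icc (-δ : ℝ) δ) a₀ ρ δ M K := by
    refine IsPicardLindelof.of_time_independent (fun w hw => ?_) hK ?_
    · rw [hsame]
      exact hM _ ⟨hmaps hw, dropFirst_mem_Wset w⟩
    · simp only [sub_zero, zero_sub, neg_neg, max_self]
      linarith
  obtain ⟨γ, hLip, hγ0, hball, hderiv⟩ :=
    exists_lipschitz_solution hPL (Metric.mem_closedBall.2 haδ)
  have hW : ∀ t ∈ Set.Icc (-δ : ℝ) δ, γ t ∈ Wset m h := by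
    intro t ht
    have hcomp : ∀ s ∈ Set.Icc (-δ : ℝ) δ,
        HasDerivWithinAt (fun s => (γ s).1 0) 0 (Set.Icc (-δ : ℝ) δ) s := by
      intro s hs
      have := hasDerivWithinAt_pi.1 (hderiv s hs).fst 0
      simpa [Dvec, hj.symm] using this
    have hconst := (convex_Icc (-δ : ℝ) δ).norm_image_sub_le_of_norm_hasDerivWithin_le
      (C := 0) hcomp (fun _ _ => by simp) h0 ht
    have hz : (γ t).1 0 = (γ 0).1 0 := by
      simpa [sub_eq_zero] using hconst
    have hγ0' : γ 0 = a := hγ0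
    rw [hγ0'] at hz
    exact hz.trans ha
  refine ⟨γ, hLip, hγ0, fun t ht => ⟨hball t, hW t ht⟩, fun t ht => ?_⟩
  have := hderiv t ht
  rwa [hsame, dropFirst_of_mem_Wset (hW t ht)] at this

end

/-- If around every point of `U` the function `φ` is uniformly approximable
by `C¹` functions `φ_ε` whose intrinsic derivatives `D^{φ_ε}_jφ_ε` converge uniformly to a
continuous `ω`, then `D^φφ = ω` in the broad* sense on `U`. -/
theorem statement11 (m h : ℕ) [NeZero m] (hm : 2 ≤ m) (hh : 1 ≤ h)
    (B : Fin h → Matrix (Fin m) (Fin m) ℝ)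
    (hskew : ∀ i, (B i).transpose = - B i) (hBli : LinearIndependent ℝ B)
    (U : Set (G m h)) (hUW : U ⊆ Wset m h) (hUopen : RelOpen m h U)
    (φ : G m h → ℝ) (hφ : ContinuousOn φ U)
    (ω : G m h → Fin m → ℝ)
    (hω : ∀ j : Fin m, j ≠ 0 → ContinuousOn (fun w => ω w j) U)
    (happrox : ∀ a ∈ U, ∃ r > (0:ℝ),
      {p : G m h | eDist p a < r} ∩ Wset m h ⊆ U ∧
      ∃ φε : ℝ → G m h → ℝ,
        (∀ ε ∈ Set.Ioo (0:ℝ) 1, ContDiffOn ℝ 1 (φε ε) {p : G m h | eDist p a < r}) ∧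
        TendstoUniformlyOn (fun ε => φε ε) φ (𝓝[Set.Ioo (0:ℝ) 1] 0)
          ({p : G m h | eDist p a < r} ∩ Wset m h) ∧
        (∀ j : Fin m, j ≠ 0 →
          TendstoUniformlyOn
            (fun ε w => fderiv ℝ (φε ε) w (Dvec B (φε ε) j w))
            (fun w => ω w j) (𝓝[Set.Ioo (0:ℝ) 1] 0)
            ({p : G m h | eDist p a < r} ∩ Wset m h))) :
    IsBroadStar B U φ ω := by
  intro a₀ ha₀
  obtain ⟨r, hr, hVU, φε, hC1, hφlim, hωlim⟩ := happrox a₀ ha₀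
  set V : Set (G m h) := {p | eDist p a₀ < r} with hV
  have hVopen : IsOpen V := isOpen_lt (continuous_eDist a₀) continuous_const
  have ha₀V : a₀ ∈ V := by simpa [hV, eDist] using hr
  obtain ⟨ρ', hρ', hball⟩ := Metric.nhds_basis_closedBall.mem_iff.1 (hVopen.mem_nhds ha₀V)
  lift ρ' to NNReal using hρ'.le with ρ
  set K : Set (G m h) := Metric.closedBall a₀ ρ ∩ Wset m h with hK
  have hKc : IsCompact K := (isCompact_closedBall a₀ _).inter_right isClosed_Wset
  have hKV : K ⊆ V ∩ Wset m h := Set.inter_subset_inter_left _ hball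
  have hKU : K ⊆ U := hKV.trans hVU
  obtain ⟨C, hC⟩ := hKc.exists_bound_of_continuousOn (hφ.mono hKU)
  obtain ⟨M', hM'⟩ := ((isCompact_Icc (a := -(C + 1)) (b := C + 1)).prod
    hKc).exists_bound_of_continuousOn
    (f := fun q : ℝ × G m h => fun j : Fin m => Dvec B (fun _ => q.1) j q.2)
    (continuous_pi fun j => (contDiff_Dvec B j).continuous).continuousOn
  set M : NNReal := M'.toNNReal with hMdef
  have hM : ∀ j : Fin m, ∀ s ∈ Set.Icc (-(C + 1)) (C + 1), ∀ w ∈ K,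
      ‖Dvec B (fun _ => s) j w‖ ≤ M := fun j s hs w hw =>
    (norm_le_pi_norm (fun j : Fin m => Dvec B (fun _ => s) j w) j).trans
      ((hM' (s, w) ⟨hs, hw⟩).trans (Real.le_coe_toNNReal M'))
  obtain ⟨δ, hδ, hδr, hδρ⟩ : ∃ δ : NNReal, 0 < δ ∧ (δ : ℝ) < r ∧ (M * δ + δ : ℝ) ≤ ρ := by
    have hden : (0 : ℝ) < M + 1 := by positivity
    have hpos : 0 < min (r / 2) (ρ / (M + 1)) := lt_min (by positivity) (by positivity)
    refine ⟨⟨min (r / 2) (ρ / (M + 1)), hpos.le⟩, hpos, ?_, ?_⟩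
    · exact (min_le_left _ _).trans_lt (half_lt_self hr)
    · have := (le_div_iff₀ hden).1 (min_le_right (r / 2) ((ρ : ℝ) / (M + 1)))
      change (M : ℝ) * min (r / 2) (ρ / (M + 1)) + min (r / 2) (ρ / (M + 1)) ≤ ρ
      linarith
  have hfreq : ∃ᶠ ε in 𝓝[Set.Ioo (0:ℝ) 1] 0,
      ε ∈ Set.Ioo (0:ℝ) 1 ∧ ∀ w ∈ V ∩ Wset m h, dist (φ w) (φε ε w) < 1 := by
    have : (𝓝[Set.Ioo (0:ℝ) 1] 0).NeBot := by
      rw [nhdsWithin_Ioo_eq_nhdsGT one_pos]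
      infer_instance
    exact (eventually_mem_nhdsWithin.and
      (Metric.tendstoUniformlyOn_iff.1 hφlim 1 one_pos)).frequently
  obtain ⟨ε, hεlim, hε⟩ := exists_seq_forall_of_frequently hfreq
  have hδ0 : (0 : ℝ) ∈ Set.Icc (-δ : ℝ) δ := by simp
  refine ⟨r, δ, hδ, hδr, fun j hj => ?_⟩
  suffices H : ∀ a : G m h, a ∈ U → eDist a a₀ ≤ δ → ∃ γ : ℝ → G m h,
      (∀ t ∈ Set.Icc (-δ : ℝ) δ, γ t ∈ K) ∧ γ 0 = a ∧
      (∀ t ∈ Set.Icc (-δ : ℝ) δ,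
        HasDerivWithinAt γ (Dvec B φ j (γ t)) (Set.Icc (-δ : ℝ) δ) t) ∧
      (∀ t ∈ Set.Icc (-δ : ℝ) δ, φ (γ t) - φ a = ∫ s in (0:ℝ)..t, ω (γ s) j) by
    choose! E hE using H
    refine ⟨E, fun a ha had => ?_⟩
    obtain ⟨h1, h2, h3, h4⟩ := hE a ha had
    exact ⟨fun t ht => ⟨hKU (h1 t ht), (hKV (h1 t ht)).1.le⟩, h2, h3, h4⟩
  intro a ha had
  have hvn : ∀ n, ∀ w ∈ K, ‖Dvec B (φε (ε n)) j w‖ ≤ M := by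
    intro n w hw
    refine hM j (φε (ε n) w) ?_ w hw
    have h1 := (hε n).2 w (hKV hw)
    have h2 := hC w hw
    rw [Real.dist_eq, abs_lt] at h1
    rw [Real.norm_eq_abs, abs_le] at h2
    constructor <;> linarith [h1.1, h1.2, h2.1, h2.2]
  choose γ hLip hγ0 hγK hγd using fun n => exists_integralCurve_Dvec B hj (hUW ha₀)
    ((hC1 (ε n) (hε n).1).mono hball) (hvn n) hδρ (hUW ha) ((dist_le_eDist a a₀).trans had)
  obtain ⟨γ₀, hγ₀c, ψ, hψ, hlim⟩ :=
    exists_subseq_tendsto_of_lipschitz hKc (neg_le_self δ.2) hLip hγK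
  have hγ₀K : ∀ t ∈ Set.Icc (-δ : ℝ) δ, γ₀ t ∈ K := fun t ht =>
    hKc.isClosed.mem_of_tendsto (hlim t ht) (Eventually.of_forall fun n => hγK _ t ht)
  have hγ₀0 : γ₀ 0 = a := tendsto_nhds_unique (hlim 0 hδ0) (by simp [hγ0])
  have hεψ : Tendsto (fun n => ε (ψ n)) atTop (𝓝[Set.Ioo (0:ℝ) 1] 0) :=
    hεlim.comp hψ.tendsto_atTop
  have hlimK : ∀ t ∈ Set.Icc (-δ : ℝ) δ,
      Tendsto (fun n => γ (ψ n) t) atTop (𝓝[K] (γ₀ t)) := fun t ht =>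
    tendsto_nhdsWithin_iff.2 ⟨hlim t ht, Eventually.of_forall fun n => hγK _ t ht⟩
  have hφK := (hφlim.mono hKV).seq_tendstoUniformlyOn _ hεψ
  have hωK := ((hωlim j hj).mono hKV).seq_tendstoUniformlyOn _ hεψ
  have hωc : ContinuousOn (fun w => ω w j) K := (hω j hj).mono hKU
  have hφlim' : ∀ t ∈ Set.Icc (-δ : ℝ) δ,
      Tendsto (fun n => φε (ε (ψ n)) (γ (ψ n) t)) atTop (𝓝 (φ (γ₀ t))) := fun t ht =>
    hφK.tendsto_comp (hφ.mono hKU _ (hγ₀K t ht)) (hlimK t ht)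
  have hωlim' := fun t (ht : t ∈ Set.Icc (-δ : ℝ) δ) =>
    hωK.tendsto_comp (hωc _ (hγ₀K t ht)) (hlimK t ht)
  have hγint := sub_eq_integral_of_tendsto hδ0 (F := fun n => γ (ψ n))
    (f := fun n t => Dvec B (φε (ε (ψ n))) j (γ (ψ n) t)) (F₀ := γ₀)
    (f₀ := fun t => Dvec B φ j (γ₀ t)) (C := M) (fun n => hγd (ψ n))
    (fun n => (continuousOn_Dvec B j (hC1 _ (hε (ψ n)).1).continuousOn).comp
      (hLip _).continuous.continuousOn fun t ht => (hKV (hγK _ t ht)).1)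
    (Eventually.of_forall fun n t ht => hvn _ _ (hγK _ t ht)) hlim
    (fun t ht => ((contDiff_Dvec B j).continuous.tendsto (φ (γ₀ t), γ₀ t)).comp
      ((hφlim' t ht).prodMk_nhds (hlim t ht)))
  refine ⟨γ₀, hγ₀K, hγ₀0, fun t ht => ?_, ?_⟩
  · have hDc : ContinuousOn (fun t => Dvec B φ j (γ₀ t)) (Set.Icc (-δ : ℝ) δ) :=
      (continuousOn_Dvec B j (hφ.mono hKU)).comp hγ₀c.continuousOn hγ₀K
    have : Fact (t ∈ Set.Icc (-δ : ℝ) δ) := ⟨ht⟩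
    have hd := (intervalIntegral.integral_hasDerivWithinAt_right (a := 0) (b := t)
      (s := Set.Icc (-δ : ℝ) δ) (t := Set.Icc (-δ : ℝ) δ)
      (hDc.mono (Set.uIcc_subset_Icc hδ0 ht)).intervalIntegrable
      (hDc.stronglyMeasurableAtFilter_nhdsWithin measurableSet_Icc t) (hDc t ht)).add_const (γ₀ 0)
    exact hd.congr_of_mem (fun s hs => by rw [← hγint s hs, sub_add_cancel]) ht
  · obtain ⟨Cω, hCω⟩ := hKc.exists_bound_of_continuousOn hωc
    have hφint := sub_eq_integral_of_tendsto hδ0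
      (F := fun n t => φε (ε (ψ n)) (γ (ψ n) t))
      (f := fun n t => fderiv ℝ (φε (ε (ψ n))) (γ (ψ n) t)
        (Dvec B (φε (ε (ψ n))) j (γ (ψ n) t)))
      (F₀ := fun t => φ (γ₀ t)) (f₀ := fun t => ω (γ₀ t) j) (C := Cω + 1)
      (fun n t ht => ?_) (fun n => ?_) ?_ hφlim' hωlim'
    · simpa only [hγ₀0] using hφint
    · have hdiff : DifferentiableAt ℝ (φε (ε (ψ n))) (γ (ψ n) t) :=
        ((hC1 _ (hε (ψ n)).1).differentiableOn one_ne_zero).differentiableAt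
          (hVopen.mem_nhds (hKV (hγK _ t ht)).1)
      exact hdiff.hasFDerivAt.comp_hasDerivWithinAt t (hγd _ t ht)
    · have hC1n := hC1 _ (hε (ψ n)).1
      refine ContinuousOn.comp (t := V) (g := fun w => fderiv ℝ (φε (ε (ψ n))) w
        (Dvec B (φε (ε (ψ n))) j w)) ?_ (hLip _).continuous.continuousOn
        fun t ht => (hKV (hγK _ t ht)).1
      exact (hC1n.continuousOn_fderiv_of_isOpen hVopen le_rfl).clm_apply
        (continuousOn_Dvec B j hC1n.continuousOn)
    · filter_upwards [Metric.tendstoUniformlyOn_iff.1 hωK 1 one_pos] with n hn t ht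
      have h1 := hn _ (hγK (ψ n) t ht)
      have h2 := hCω _ (hγK (ψ n) t ht)
      rw [dist_comm, dist_eq_norm] at h1
      have h3 := norm_le_norm_add_norm_sub' (fderiv ℝ (φε (ε (ψ n))) (γ (ψ n) t)
        (Dvec B (φε (ε (ψ n))) j (γ (ψ n) t))) (ω (γ (ψ n) t) j)
      exact h3.trans (add_le_add h2 h1.le)

end Step2
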